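/- The only real solution of the system of polynomial equations q_1 = q_2 = ... = q_9 = 0 is (h_1, h_2, h_3, h_4) = (0, 0, 0, 0), where q_4,...,q_9 are obtained from q_1, q_2, q_3 by applying the cyclic variable substitutions σ: (h_1,h_2,h_3,h_4) ↦ (h_3,h_2,h_4,h_1) and σ^2: (h_1,h_2,h_3,h_4) ↦ (h_4,h_2,h_1,h_3). -/

import Mathlib

noncomputable def g1 (h1 h2 h3 h4 : ℝ) : ℝ :=
  5*h1^4 + 20*h1^3*h2 + 32*h1^2*h2^2 + 24*h1*h2^3 + 12*h2^4 + 10*h1^3*h3 + 32*h1^2*h2*h3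
  + 36*h1*h2^2*h3 + 24*h2^3*h3 + 5*h1^2*h3^2 + 12*h1*h2*h3^2 + 12*h2^2*h3^2 + 10*h1^3*h4
  + 32*h1^2*h2*h4 + 36*h1*h2^2*h4 + 24*h2^3*h4 + 16*h1^2*h3*h4 + 36*h1*h2*h3*h4
  + 36*h2^2*h3*h4 + 6*h1*h3^2*h4 + 12*h2*h3^2*h4 + 5*h1^2*h4^2 + 12*h1*h2*h4^2
  + 12*h2^2*h4^2 + 6*h1*h3*h4^2 + 12*h2*h3*h4^2 - 3*h3^2*h4^2

noncomputable def g2 (h1 h2 h3 h4 : ℝ) : ℝ :=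
  5*h1^4 + 20*h1^3*h2 + 24*h1^2*h2^2 + 8*h1*h2^3 - 4*h2^4 + 10*h1^3*h3 + 24*h1^2*h2*h3
  + 12*h1*h2^2*h3 - 8*h2^3*h3 + 5*h1^2*h3^2 + 4*h1*h2*h3^2 - 4*h2^2*h3^2 + 10*h1^3*h4
  + 24*h1^2*h2*h4 + 12*h1*h2^2*h4 - 8*h2^3*h4 + 16*h1^2*h3*h4 + 20*h1*h2*h3*h4
  - 20*h2^2*h3*h4 + 6*h1*h3^2*h4 - 12*h2*h3^2*h4 + 5*h1^2*h4^2 + 4*h1*h2*h4^2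
  - 4*h2^2*h4^2 + 6*h1*h3*h4^2 - 12*h2*h3*h4^2 - 3*h3^2*h4^2

noncomputable def g3 (h1 h2 h3 h4 : ℝ) : ℝ :=
  5*h1^4 + 20*h1^3*h2 + 24*h1^2*h2^2 + 8*h1*h2^3 - 4*h2^4 + 10*h1^3*h3 + 24*h1^2*h2*h3
  + 12*h1*h2^2*h3 - 8*h2^3*h3 + 5*h1^2*h3^2 + 4*h1*h2*h3^2 - 4*h2^2*h3^2 + 10*h1^3*h4
  + 24*h1^2*h2*h4 + 12*h1*h2^2*h4 - 8*h2^3*h4 + 8*h1^2*h3*h4 + 4*h1*h2*h3*h4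
  - 4*h2^2*h3*h4 - 2*h1*h3^2*h4 + 4*h2*h3^2*h4 + 5*h1^2*h4^2 + 4*h1*h2*h4^2
  - 4*h2^2*h4^2 - 2*h1*h3*h4^2 + 4*h2*h3*h4^2 + 5*h3^2*h4^2

noncomputable def q1 (h1 h2 h3 h4 : ℝ) : ℝ :=
  81 * h1 * (h1 + 2*h2 + h3 + h4) * g1 h1 h2 h3 h4

noncomputable def q2 (h1 h2 h3 h4 : ℝ) : ℝ :=
  81 * (h1 + h2) * (h1 + h2 + h3 + h4) * g2 h1 h2 h3 h4

noncomputable def q3 (h1 h2 h3 h4 : ℝ) : ℝ :=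
  81 * (h1 + h2 + h3) * (h1 + h2 + h4) * g3 h1 h2 h3 h4

/-- Three real quadratic equations that are permuted cyclically have only the trivial solution. -/
theorem eq_zero_of_cyclic_quadrics {X Y Z : ℝ}
    (hX : 3 * X ^ 2 - Y ^ 2 - Z ^ 2 + 4 * Y * Z = 0)
    (hY : 3 * Y ^ 2 - Z ^ 2 - X ^ 2 + 4 * Z * X = 0)
    (hZ : 3 * Z ^ 2 - X ^ 2 - Y ^ 2 + 4 * X * Y = 0) :
    X = 0 ∧ Y = 0 ∧ Z = 0 := by
  have eq_zero_of_eq : ∀ {U V : ℝ}, 3 * V ^ 2 + 2 * U ^ 2 = 0 → U = 0 ∧ V = 0 :=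
    fun {U V} h => ⟨by nlinarith [sq_nonneg U, sq_nonneg V], by nlinarith [sq_nonneg U, sq_nonneg V]⟩
  have hXY : (X - Y) * (X + Y - Z) = 0 := by linear_combination (hX - hY) / 4
  have hYZ : (Y - Z) * (Y + Z - X) = 0 := by linear_combination (hY - hZ) / 4
  rcases mul_eq_zero.1 hXY with h | h
  · obtain rfl : X = Y := by linarith
    obtain ⟨rfl, rfl⟩ := eq_zero_of_eq (U := X) (V := Z) (by linear_combination hZ)
    exact ⟨rfl, rfl, rfl⟩
  rcases mul_eq_zero.1 hYZ with h' | h'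
  · obtain rfl : Y = Z := by linarith
    obtain ⟨rfl, rfl⟩ := eq_zero_of_eq (U := Y) (V := X) (by linear_combination hX)
    exact ⟨rfl, rfl, rfl⟩
  · obtain rfl : Y = 0 := by linarith
    obtain rfl : X = Z := by linarith
    obtain ⟨rfl, -⟩ := eq_zero_of_eq (U := X) (V := 0) (by linear_combination hX)
    exact ⟨rfl, rfl, rfl⟩

/-- If each of `b`, `c`, `d` either equals `a` or makes the corresponding quadratic form vanish,
then all four numbers are equal. -/
theorem all_eq_of_mul_quadric_eq_zero {a b c d : ℝ}
    (hb : (a - b) * (3 * (a + b - c - d) ^ 2 + 2 * (a - b) ^ 2 - 6 * (c - d) ^ 2) = 0)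
    (hc : (a - c) * (3 * (a + c - b - d) ^ 2 + 2 * (a - c) ^ 2 - 6 * (b - d) ^ 2) = 0)
    (hd : (a - d) * (3 * (a + d - b - c) ^ 2 + 2 * (a - d) ^ 2 - 6 * (b - c) ^ 2) = 0) :
    a = b ∧ a = c ∧ a = d := by
  have eq_of_eq : ∀ {a b : ℝ}, 5 * (a - b) ^ 2 = 0 → a = b := fun h => by
    have := pow_eq_zero_iff (two_ne_zero) |>.1 ((mul_eq_zero.1 h).resolve_left (by norm_num))
    linarith
  have two_quadrics : ∀ {a b c : ℝ},
      3 * (b - c) ^ 2 + 2 * (a - b) ^ 2 - 6 * (c - a) ^ 2 = 0 →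
      3 * (b - c) ^ 2 + 2 * (a - c) ^ 2 - 6 * (b - a) ^ 2 = 0 → a = b ∧ a = c := by
    intro a b c h₁ h₂
    have h : (b - c) * (b + c - 2 * a) = 0 := by linear_combination (h₁ - h₂) / 8
    rcases mul_eq_zero.1 h with h | h
    · obtain rfl : b = c := by linarith
      have := eq_of_eq (a := a) (b := b) (by linear_combination h₁ * (-5 / 4))
      exact ⟨this, this⟩
    · obtain rfl : c = 2 * a - b := by linarith
      have := eq_of_eq (a := a) (b := b) (by linear_combination h₁ * (5 / 8))
      exact ⟨this, by linarith⟩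
  rcases mul_eq_zero.1 hb with h₁ | h₁ <;> rcases mul_eq_zero.1 hc with h₂ | h₂ <;>
    rcases mul_eq_zero.1 hd with h₃ | h₃
  · exact ⟨by linarith, by linarith, by linarith⟩
  · obtain rfl : a = b := by linarith
    obtain rfl : a = c := by linarith
    exact ⟨rfl, rfl, eq_of_eq (by linear_combination h₃)⟩
  · obtain rfl : a = b := by linarith
    obtain rfl : a = d := by linarith
    exact ⟨rfl, eq_of_eq (by linear_combination h₂), rfl⟩
  · obtain rfl : a = b := by linarith
    obtain ⟨h, h'⟩ := two_quadrics (a := a) (b := c) (c := d)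
      (by linear_combination h₂) (by linear_combination h₃)
    exact ⟨rfl, h, h'⟩
  · obtain rfl : a = c := by linarith
    obtain rfl : a = d := by linarith
    exact ⟨eq_of_eq (by linear_combination h₁), rfl, rfl⟩
  · obtain rfl : a = c := by linarith
    obtain ⟨h, h'⟩ := two_quadrics (a := a) (b := b) (c := d)
      (by linear_combination h₁) (by linear_combination h₃)
    exact ⟨h, rfl, h'⟩
  · obtain rfl : a = d := by linarith
    obtain ⟨h, h'⟩ := two_quadrics (a := a) (b := b) (c := c)
      (by linear_combination h₁) (by linear_combination h₂)
    exact ⟨h, h', rfl⟩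
  · obtain ⟨hX, hY, hZ⟩ := eq_zero_of_cyclic_quadrics
      (X := a + b - c - d) (Y := a + c - b - d) (Z := a + d - b - c)
      (by linear_combination h₁) (by linear_combination h₂) (by linear_combination h₃)
    exact ⟨by linarith, by linarith, by linarith⟩

/-- The quartic factors of `q1`, `q2`, `q3` do not contribute common real zeros. In the
orthogonal coordinates of the root system `D₄` the three products of linear forms below are
differences of squares of coordinates. -/
theorem linear_factors_eq_zero {h1 h2 h3 h4 : ℝ}
    (e1 : q1 h1 h2 h3 h4 = 0) (e2 : q2 h1 h2 h3 h4 = 0) (e3 : q3 h1 h2 h3 h4 = 0) :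
    h1 * (h1 + 2 * h2 + h3 + h4) = 0 ∧ (h1 + h2) * (h1 + h2 + h3 + h4) = 0 ∧
      (h1 + h2 + h3) * (h1 + h2 + h4) = 0 := by
  simp only [q1, q2, q3, g1, g2, g3] at e1 e2 e3
  obtain ⟨hb, hc, hd⟩ := all_eq_of_mul_quadric_eq_zero
    (a := (h1 + h2 + (h3 + h4) / 2) ^ 2) (b := (h2 + (h3 + h4) / 2) ^ 2)
    (c := ((h3 + h4) / 2) ^ 2) (d := ((h4 - h3) / 2) ^ 2)
    (by linear_combination e1 / 81) (by linear_combination e2 / 81)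
    (by linear_combination e3 / 81)
  exact ⟨by linear_combination hb, by linear_combination hc, by linear_combination hd⟩

/-- the only real solution of `q₁ = q₂ = ⋯ = q₉ = 0` is
`(h₁,h₂,h₃,h₄) = (0,0,0,0)`, where `q₄,…,q₉` are obtained from `q₁,q₂,q₃` via the
cyclic substitutions `σ : (h₁,h₂,h₃,h₄) ↦ (h₃,h₂,h₄,h₁)` and
`σ² : (h₁,h₂,h₃,h₄) ↦ (h₄,h₂,h₁,h₃)`. -/
theorem only_common_zero_is_origin :
    ∀ h1 h2 h3 h4 : ℝ,
      q1 h1 h2 h3 h4 = 0 → q2 h1 h2 h3 h4 = 0 → q3 h1 h2 h3 h4 = 0 →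
      q1 h3 h2 h4 h1 = 0 → q2 h3 h2 h4 h1 = 0 → q3 h3 h2 h4 h1 = 0 →
      q1 h4 h2 h1 h3 = 0 → q2 h4 h2 h1 h3 = 0 → q3 h4 h2 h1 h3 = 0 →
      h1 = 0 ∧ h2 = 0 ∧ h3 = 0 ∧ h4 = 0 := by
  intro h1 h2 h3 h4 e1 e2 e3 e4 e5 e6 e7 e8 e9
  obtain ⟨a1, a2, a3⟩ := linear_factors_eq_zero e1 e2 e3
  obtain ⟨b1, b2, b3⟩ := linear_factors_eq_zero e4 e5 e6
  obtain ⟨c1, c2, c3⟩ := linear_factors_eq_zero e7 e8 e9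
  have highest : h1 + 2 * h2 + h3 + h4 = 0 := by
    by_contra h
    obtain rfl : h1 = 0 := (mul_eq_zero.1 a1).resolve_right h
    obtain rfl : h3 = 0 := (mul_eq_zero.1 b1).resolve_right fun h' => h (by linarith)
    obtain rfl : h4 = 0 := (mul_eq_zero.1 c1).resolve_right fun h' => h (by linarith)
    obtain rfl : h2 = 0 := by simpa using a2
    simp at h
  obtain rfl : h2 = 0 := by
    by_contra h
    have k1 : h1 + h2 = 0 := (mul_eq_zero.1 a2).resolve_right fun h' => h (by linarith)
    have k3 : h3 + h2 = 0 := (mul_eq_zero.1 b2).resolve_right fun h' => h (by linarith)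
    have k4 : h4 + h2 = 0 := (mul_eq_zero.1 c2).resolve_right fun h' => h (by linarith)
    exact h (by linarith)
  have sq_sum : h1 ^ 2 + h3 ^ 2 + h4 ^ 2 = 0 := by
    linear_combination 3 * (h1 + h3 + h4) * highest - 2 * (a3 + b3 + c3)
  refine ⟨?_, rfl, ?_, ?_⟩ <;> nlinarith [sq_nonneg h1, sq_nonneg h3, sq_nonneg h4]
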